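/- arXiv:2011.12651 — 4 statements merged into one kernel-verified Lean document; each statement's English description precedes it below -/
import Mathlib

section
/- Let Ψ : ℝ^d → ℝ^n be a feature map, X ⊂ ℝ^d a finite sample set with m elements, and X̃ ⊂ X a subset with m̃ elements such that Ψ_{X̃} has full column rank. Let Z ∈ ℝ^{m̃×(m−m̃)} be the unique solution of G_{X̃,X̃} Z = G_{X̃, X∖X̃}. Then the vector Δ ∈ ℝ^{m−m̃} whose entries are the approximation errors E(X̃,x) for x ∈ X∖X̃ satisfies Δ = diag(G_{X∖X̃, X∖X̃})ᵀ − 𝟙ᵀ · (G_{X̃, X∖X̃} ⊙ Z), where 𝟙 ∈ ℝ^{m̃} is the vector of all ones, ⊙ denotes the Hadamard (entrywise) product, and diag(M) denotes the vector of diagonal entries of M. -/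
open Matrix

theorem dotProduct_sub_mulVec_self_of_normal_eq {m n R : Type*} [Fintype m] [Fintype n]
    [CommRing R] (A : Matrix m n R) (b : m → R) (z : n → R)
    (hz : (Aᵀ * A) *ᵥ z = Aᵀ *ᵥ b) (c : n → R) :
    (b - A *ᵥ c) ⬝ᵥ (b - A *ᵥ c) =
      b ⬝ᵥ b - (Aᵀ *ᵥ b) ⬝ᵥ z + (A *ᵥ (z - c)) ⬝ᵥ (A *ᵥ (z - c)) := by
  have adj (u : n → R) (v : m → R) : (A *ᵥ u) ⬝ᵥ v = u ⬝ᵥ (Aᵀ *ᵥ v) := by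
    rw [dotProduct_mulVec, vecMul_transpose]
  have key (u : n → R) : (A *ᵥ u) ⬝ᵥ (A *ᵥ z) = (A *ᵥ u) ⬝ᵥ b := by
    rw [adj, adj, mulVec_mulVec, hz]
  have hzz := key z
  have hcz := key c
  have hbz : (Aᵀ *ᵥ b) ⬝ᵥ z = (A *ᵥ z) ⬝ᵥ b := by rw [adj, dotProduct_comm]
  rw [hbz, mulVec_sub]
  simp only [sub_dotProduct, dotProduct_sub]
  rw [dotProduct_comm b (A *ᵥ c), dotProduct_comm (A *ᵥ z) (A *ᵥ c), hzz, hcz]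
  ring

/-- The vector `Δ` of approximation errors of the samples in `X ∖ X̃` satisfies
`Δ = diag(G_{X∖X̃,X∖X̃})ᵀ − 𝟙ᵀ (G_{X̃,X∖X̃} ⊙ Z)` where `Z` solves
`G_{X̃,X̃} Z = G_{X̃,X∖X̃}`. Here `y` enumerates the samples in `X ∖ X̃`. -/
theorem error_vector_formula {d n mt r : ℕ}
    (Ψ : (Fin d → ℝ) → (Fin n → ℝ))
    (xt : Fin mt → (Fin d → ℝ)) (y : Fin r → (Fin d → ℝ))
    (PsiXt : Matrix (Fin n) (Fin mt) ℝ)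
    (hPsiXt : PsiXt = Matrix.of fun i j => Ψ (xt j) i)
    (PsiY : Matrix (Fin n) (Fin r) ℝ)
    (hPsiY : PsiY = Matrix.of fun i j => Ψ (y j) i)
    (hrank : PsiXt.rank = mt)
    (Z : Matrix (Fin mt) (Fin r) ℝ)
    (hZ : (PsiXtᵀ * PsiXt) * Z = PsiXtᵀ * PsiY) :
    ∀ j : Fin r,
      IsLeast (Set.range fun c : Fin mt → ℝ => ∑ i, (Ψ (y j) i - (PsiXt *ᵥ c) i) ^ 2)
        ((PsiYᵀ * PsiY) j j - ∑ i, ((PsiXtᵀ * PsiY) i j * Z i j)) := by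
  intro j
  have hy : PsiY.col j = Ψ (y j) := by rw [hPsiY]; rfl
  have hz : (PsiXtᵀ * PsiXt) *ᵥ Z.col j = PsiXtᵀ *ᵥ PsiY.col j :=
    congrArg (fun M : Matrix (Fin mt) (Fin r) ℝ => M.col j) hZ
  have hval : (PsiYᵀ * PsiY) j j - ∑ i, ((PsiXtᵀ * PsiY) i j * Z i j) =
      PsiY.col j ⬝ᵥ PsiY.col j - (PsiXtᵀ *ᵥ PsiY.col j) ⬝ᵥ Z.col j := rfl
  have herr (c : Fin mt → ℝ) : ∑ i, (Ψ (y j) i - (PsiXt *ᵥ c) i) ^ 2 =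
      (PsiY.col j - PsiXt *ᵥ c) ⬝ᵥ (PsiY.col j - PsiXt *ᵥ c) := by
    simp only [hy, dotProduct, Pi.sub_apply, sq]
  simp only [hval, herr, dotProduct_sub_mulVec_self_of_normal_eq PsiXt _ _ hz]
  refine ⟨⟨Z.col j, by simp⟩, ?_⟩
  rintro _ ⟨c, rfl⟩
  exact le_add_of_nonneg_right (Finset.sum_nonneg fun i _ => mul_self_nonneg _)
end

section
/- Let Ψ : ℝ^d → ℝ^n be a feature map and X̃ ⊂ ℝ^d a finite set such that Ψ_{X̃} has full column rank. Define H(X̃, x) := G_{X̃,X̃}⁻¹ G_{X̃,x} and E(X̃,x) := k(x,x) − G_{x,X̃} G_{X̃,X̃}⁻¹ G_{X̃,x}. Then for any x_new ∈ ℝ^d with Ψ(x_new) ∉ span Ψ_{X̃} and any x ∈ ℝ^d, it holds that H(X̃ ∪ {x_new}, x) = [H(X̃,x) − H(X̃,x_new)·λ ; λ], where λ = (k(x_new, x) − G_{x_new, X̃} H(X̃, x)) / E(X̃, x_new), i.e., the first m̃ entries of H(X̃ ∪ {x_new}, x) equal H(X̃,x) − λ H(X̃,x_new) and the last entry equals λ.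 -/
open Matrix

section NormalEquations

variable {m n : Type*} [Fintype n] {A : Matrix m n ℝ}

theorem Matrix.linearIndependent_col_of_rank_eq_card (hA : A.rank = Fintype.card n) :
    LinearIndependent ℝ A.col := by
  rw [linearIndependent_iff_card_eq_finrank_span, ← hA, rank_eq_finrank_span_cols, Set.finrank]

theorem Matrix.mulVec_mem_span_col (w : n → ℝ) :
    A *ᵥ w ∈ Submodule.span ℝ (Set.range A.col) := by
  rw [← range_mulVecLin]
  exact ⟨w, rfl⟩

variable [Fintype m] [DecidableEq n]

theorem Matrix.isUnit_transpose_mul_self_of_linearIndependent_col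
    (hA : LinearIndependent ℝ A.col) : IsUnit (Aᵀ * A) := by
  rw [← mulVec_injective_iff_isUnit]
  have hker := ker_mulVecLin_transpose_mul_self A
  rw [(LinearMap.ker_eq_bot (f := A.mulVecLin)).mpr (mulVec_injective_iff.mpr hA)] at hker
  exact LinearMap.ker_eq_bot.mp hker

/-- The least-squares residual is orthogonal to the columns of the matrix. -/
theorem Matrix.transpose_mulVec_residual_eq_zero
    (hA : LinearIndependent ℝ A.col) (y : m → ℝ) :
    Aᵀ *ᵥ (y - A *ᵥ ((Aᵀ * A)⁻¹ *ᵥ (Aᵀ *ᵥ y))) = 0 := by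
  have hdet := (isUnit_iff_isUnit_det _).mp (isUnit_transpose_mul_self_of_linearIndependent_col hA)
  rw [mulVec_sub, mulVec_mulVec _ Aᵀ A, mulVec_mulVec, mul_nonsing_inv _ hdet, one_mulVec,
    sub_self]

/-- A solution of the normal equations is unique. -/
theorem Matrix.inv_transpose_mul_self_mulVec_eq
    (hA : LinearIndependent ℝ A.col) {y : m → ℝ} {w : n → ℝ}
    (hw : Aᵀ *ᵥ (y - A *ᵥ w) = 0) : (Aᵀ * A)⁻¹ *ᵥ (Aᵀ *ᵥ y) = w := by
  have hdet := (isUnit_iff_isUnit_det _).mp (isUnit_transpose_mul_self_of_linearIndependent_col hA)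
  rw [mulVec_sub, sub_eq_zero] at hw
  rw [hw, mulVec_mulVec _ Aᵀ A, mulVec_mulVec, nonsing_inv_mul _ hdet, one_mulVec]

end NormalEquations

/-- Update formula for `H(X̃,x) = G_{X̃,X̃}⁻¹ G_{X̃,x}` when a new sample `x_new` with
`Ψ(x_new) ∉ span Ψ_X̃` is appended: the first `m̃` entries of `H(X̃ ∪ {x_new}, x)` equal
`H(X̃,x) − λ H(X̃,x_new)` and the last entry equals
`λ = (k(x_new,x) − G_{x_new,X̃} H(X̃,x)) / E(X̃,x_new)`. -/
theorem H_update_formula {d n mt : ℕ}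
    (Ψ : (Fin d → ℝ) → (Fin n → ℝ)) (xt : Fin mt → (Fin d → ℝ)) (xnew : Fin d → ℝ)
    (PsiXt : Matrix (Fin n) (Fin mt) ℝ)
    (hPsiXt : PsiXt = Matrix.of fun i j => Ψ (xt j) i)
    (hrank : PsiXt.rank = mt)
    (hnew : Ψ xnew ∉ Submodule.span ℝ (Set.range fun j : Fin mt => Ψ (xt j)))
    (PsiExt : Matrix (Fin n) (Fin (mt + 1)) ℝ)
    (hPsiExt : PsiExt = Matrix.of fun i j => Ψ ((Fin.snoc xt xnew : Fin (mt + 1) → (Fin d → ℝ)) j) i)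
    (x : Fin d → ℝ) :
    let H : (Fin d → ℝ) → (Fin mt → ℝ) :=
      fun z => (PsiXtᵀ * PsiXt)⁻¹ *ᵥ (PsiXtᵀ *ᵥ Ψ z)
    let E : ℝ := Ψ xnew ⬝ᵥ Ψ xnew - (PsiXtᵀ *ᵥ Ψ xnew) ⬝ᵥ H xnew
    let lam : ℝ := (Ψ xnew ⬝ᵥ Ψ x - (PsiXtᵀ *ᵥ Ψ xnew) ⬝ᵥ H x) / E
    let Hext : Fin (mt + 1) → ℝ := (PsiExtᵀ * PsiExt)⁻¹ *ᵥ (PsiExtᵀ *ᵥ Ψ x)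
    (∀ i : Fin mt, Hext i.castSucc = H x i - H xnew i * lam) ∧
    Hext (Fin.last mt) = lam := by
  intro H E lam Hext
  have hA : LinearIndependent ℝ PsiXt.col :=
    linearIndependent_col_of_rank_eq_card (by simpa using hrank)
  have hcol : PsiXt.col = fun j => Ψ (xt j) := by
    rw [hPsiXt]; rfl
  have hExtCol : PsiExt.col = Fin.snoc PsiXt.col (Ψ xnew) := by
    rw [hcol, hPsiExt]
    funext j
    refine Fin.lastCases ?_ (fun i => ?_) j <;> ext <;> simp [Matrix.col]
  rw [← hcol] at hnew
  have hB : LinearIndependent ℝ PsiExt.col := hExtCol ▸ hA.finSnoc hnew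
  have hcast (i : Fin n) (j : Fin mt) : PsiExt i j.castSucc = PsiXt i j := by
    simpa using congrFun (congrFun hExtCol j.castSucc) i
  have hlast (i : Fin n) : PsiExt i (Fin.last mt) = Ψ xnew i := by
    simpa using congrFun (congrFun hExtCol (Fin.last mt)) i
  have hadj (w : Fin mt → ℝ) (v : Fin n → ℝ) : (PsiXtᵀ *ᵥ v) ⬝ᵥ w = v ⬝ᵥ PsiXt *ᵥ w := by
    rw [mulVec_transpose, dotProduct_mulVec]
  set r : (Fin d → ℝ) → (Fin n → ℝ) := fun z => Ψ z - PsiXt *ᵥ H z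
  have hr (z : Fin d → ℝ) : PsiXtᵀ *ᵥ r z = 0 := transpose_mulVec_residual_eq_zero hA (Ψ z)
  have hE : E = Ψ xnew ⬝ᵥ r xnew := by
    simp only [E, r, hadj, dotProduct_sub]
  have hE' : E = r xnew ⬝ᵥ r xnew := by
    have h : r xnew ⬝ᵥ PsiXt *ᵥ H xnew = 0 := by rw [← hadj, hr, zero_dotProduct]
    rw [hE, dotProduct_comm]
    conv_rhs => rw [show r xnew ⬝ᵥ r xnew = r xnew ⬝ᵥ (Ψ xnew - PsiXt *ᵥ H xnew) from rfl]
    rw [dotProduct_sub, h, sub_zero]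
  have hE0 : E ≠ 0 := by
    rw [hE', Ne, dotProduct_self_eq_zero]
    intro h
    exact hnew (sub_eq_zero.mp h ▸ mulVec_mem_span_col (H xnew))
  have hlam : lam * E = Ψ xnew ⬝ᵥ r x := by
    simp only [lam, div_mul_cancel₀ _ hE0, r, hadj, dotProduct_sub]
  have hres : Ψ x - PsiExt *ᵥ Fin.snoc (H x - lam • H xnew) lam = r x - lam • r xnew := by
    have hmul : PsiExt *ᵥ Fin.snoc (H x - lam • H xnew) lam
        = PsiXt *ᵥ (H x - lam • H xnew) + lam • Ψ xnew := by
      ext i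
      simp [mulVec, dotProduct, Fin.sum_univ_castSucc, hcast, hlast, mul_comm]
    rw [hmul, mulVec_sub, mulVec_smul]
    simp only [r, smul_sub]
    abel
  have hsol : Hext = Fin.snoc (H x - lam • H xnew) lam := by
    refine inv_transpose_mul_self_mulVec_eq hB ?_
    rw [hres]
    funext j
    refine Fin.lastCases ?_ (fun i => ?_) j
    · have h : (PsiExtᵀ *ᵥ (r x - lam • r xnew)) (Fin.last mt)
          = Ψ xnew ⬝ᵥ (r x - lam • r xnew) := by
        simp [mulVec, dotProduct, hlast]
      rw [h, dotProduct_sub, dotProduct_smul, ← hE, ← hlam, smul_eq_mul, sub_self, Pi.zero_apply]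
    · have h : (PsiExtᵀ *ᵥ (r x - lam • r xnew)) i.castSucc
          = (PsiXtᵀ *ᵥ (r x - lam • r xnew)) i := by
        simp [mulVec, dotProduct, hcast]
      rw [h, mulVec_sub, mulVec_smul, hr, hr, smul_zero, sub_zero, Pi.zero_apply, Pi.zero_apply]
  rw [hsol]
  exact ⟨fun i => by simp [mul_comm], by simp⟩
end

section
/- Let Ψ : ℝ^d → ℝ^n be a feature map, X ⊂ ℝ^d a finite sample set with all Ψ(x) ≠ 0 for x ∈ X. Then minimizing over x ∈ X the best rank-one approximation error min_{c ∈ ℝ^{1×m}} ‖Ψ_X − Ψ(x) c‖_F² is equivalent to maximizing over x ∈ X the quantity Σ_{x' ∈ X} k(x,x')²/k(x,x); i.e., x₀ minimizes the former if and only if x₀ maximizes the latter. -/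
open Matrix

theorem sum_sub_mul_sq_eq {ι : Type*} [Fintype ι] (v w : ι → ℝ) (hv : v ≠ 0) (t : ℝ) :
    ∑ i, (w i - v i * t) ^ 2 =
      w ⬝ᵥ w - (v ⬝ᵥ w) ^ 2 / (v ⬝ᵥ v) + (v ⬝ᵥ v) * (t - (v ⬝ᵥ w) / (v ⬝ᵥ v)) ^ 2 := by
  have hvv : v ⬝ᵥ v ≠ 0 := fun h => hv (dotProduct_self_eq_zero.mp h)
  have expand : ∑ i, (w i - v i * t) ^ 2 = w ⬝ᵥ w - 2 * t * (v ⬝ᵥ w) + t ^ 2 * (v ⬝ᵥ v) := by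
    simp only [dotProduct, Finset.mul_sum, ← Finset.sum_sub_distrib, ← Finset.sum_add_distrib]
    exact Finset.sum_congr rfl fun i _ => by ring
  rw [expand]
  field_simp
  ring

/-- The best approximation error of the vectors `w j` by multiples of `v` is the total squared
norm minus the squared norms of the projections onto `v`. -/
theorem isLeast_sum_sub_mul_sq {ι κ : Type*} [Fintype ι] [Fintype κ]
    (v : ι → ℝ) (w : κ → ι → ℝ) (hv : v ≠ 0) :
    IsLeast (Set.range fun c : κ → ℝ => ∑ i, ∑ j, (w j i - v i * c j) ^ 2)
      (∑ j, w j ⬝ᵥ w j - ∑ j, (v ⬝ᵥ w j) ^ 2 / (v ⬝ᵥ v)) := by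
  have key (c : κ → ℝ) : ∑ i, ∑ j, (w j i - v i * c j) ^ 2 =
      (∑ j, w j ⬝ᵥ w j - ∑ j, (v ⬝ᵥ w j) ^ 2 / (v ⬝ᵥ v)) +
        ∑ j, (v ⬝ᵥ v) * (c j - (v ⬝ᵥ w j) / (v ⬝ᵥ v)) ^ 2 := by
    rw [Finset.sum_comm, ← Finset.sum_sub_distrib, ← Finset.sum_add_distrib]
    exact Finset.sum_congr rfl fun j _ => sum_sub_mul_sq_eq v (w j) hv (c j)
  have hvv : 0 ≤ v ⬝ᵥ v := Finset.sum_nonneg fun i _ => mul_self_nonneg (v i)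
  refine ⟨⟨fun j => (v ⬝ᵥ w j) / (v ⬝ᵥ v), ?_⟩, ?_⟩
  · simp [key]
  · rintro _ ⟨c, rfl⟩
    simp only [key]
    exact le_add_of_nonneg_right
      (Finset.sum_nonneg fun j _ => mul_nonneg hvv (sq_nonneg _))

/-- Minimizing over `x ∈ X` the best rank-one approximation error
`min_c ‖Ψ_X − Ψ(x) c‖_F²` is equivalent to maximizing `Σ_{x' ∈ X} k(x,x')²/k(x,x)`. -/
theorem argmin_rank_one_iff_argmax_kernel {d n m : ℕ}
    (Ψ : (Fin d → ℝ) → (Fin n → ℝ)) (X : Fin m → (Fin d → ℝ))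
    (hx : ∀ j : Fin m, Ψ (X j) ≠ 0)
    (Emin : Fin m → ℝ)
    (hE : ∀ j : Fin m,
      IsLeast (Set.range fun c : Fin m → ℝ =>
        ∑ i, ∑ j', (Ψ (X j') i - Ψ (X j) i * c j') ^ 2) (Emin j))
    (j₀ : Fin m) :
    (∀ j : Fin m, Emin j₀ ≤ Emin j) ↔
      (∀ j : Fin m,
        (∑ j', (Ψ (X j) ⬝ᵥ Ψ (X j')) ^ 2 / (Ψ (X j) ⬝ᵥ Ψ (X j))) ≤
        (∑ j', (Ψ (X j₀) ⬝ᵥ Ψ (X j')) ^ 2 / (Ψ (X j₀) ⬝ᵥ Ψ (X j₀)))) := by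
  have hEmin (j : Fin m) := (hE j).unique
    (isLeast_sum_sub_mul_sq (Ψ (X j)) (fun j' => Ψ (X j')) (hx j))
  simp only [hEmin, sub_le_sub_iff_left]
end

section
/- Equivalence of reduced regression problems: let Ψ : ℝ^d → ℝ^n be a feature map, X ⊂ ℝ^d a finite sample set with m elements, X̃ ⊂ X a subset with m̃ elements such that Ψ_{X̃} has full column rank, and C ∈ ℝ^{m̃×m} with full row rank such that Ψ_X = Ψ_{X̃} C. Let Y ∈ ℝ^{d'×m}. Then the minimum-norm solution Θ̃ = Y C⁺ G_{X̃,X̃}⁻¹ of min_{Θ ∈ ℝ^{d'×m̃}} ‖Y − Θ G_{X̃,X}‖_F² satisfies Θ̃ Ψ_{X̃}ᵀ = Y Ψ_X⁺, i.e., the reduced-kernel regression function f(x) = Θ̃ G_{X̃,x} coincides with the full regression function Y Ψ_X⁺ Ψ(x) for every x ∈ ℝ^d. -/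
open Matrix

/-- `P` is the Moore–Penrose pseudoinverse of `A`. -/
def IsMoorePenrose {k l : ℕ} (A : Matrix (Fin k) (Fin l) ℝ) (P : Matrix (Fin l) (Fin k) ℝ) : Prop :=
  A * P * A = A ∧ P * A * P = P ∧ (A * P)ᵀ = A * P ∧ (P * A)ᵀ = P * A

theorem Matrix.isUnit_of_rank_eq {k : ℕ} {A : Matrix (Fin k) (Fin k) ℝ} (hA : A.rank = k) :
    IsUnit A := by
  rw [← mulVec_surjective_iff_isUnit]
  have hrange : LinearMap.range A.mulVecLin = ⊤ :=
    Submodule.eq_top_of_finrank_eq (by simpa [Matrix.rank] using hA)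
  exact LinearMap.range_eq_top.mp hrange

namespace IsMoorePenrose

theorem unique {k l : ℕ} {A : Matrix (Fin k) (Fin l) ℝ} {P Q : Matrix (Fin l) (Fin k) ℝ}
    (hP : IsMoorePenrose A P) (hQ : IsMoorePenrose A Q) : P = Q := by
  obtain ⟨p1, p2, p3, p4⟩ := hP
  obtain ⟨q1, q2, q3, q4⟩ := hQ
  have left : A * P = A * Q := by
    calc A * P = ((A * P)ᵀ) := p3.symm
      _ = ((A * Q) * (A * P))ᵀ := by rw [← Matrix.mul_assoc, q1]
      _ = (A * P) * (A * Q) := by rw [transpose_mul, p3, q3]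
      _ = A * Q := by rw [← Matrix.mul_assoc, p1]
  have right : P * A = Q * A := by
    calc P * A = ((P * A)ᵀ) := p4.symm
      _ = ((P * A) * (Q * A))ᵀ := by rw [Matrix.mul_assoc P, ← Matrix.mul_assoc A, q1]
      _ = (Q * A) * (P * A) := by rw [transpose_mul, p4, q4]
      _ = Q * A := by rw [Matrix.mul_assoc Q, ← Matrix.mul_assoc A, p1]
  calc P = P * A * P := p2.symm
    _ = Q * A * P := by rw [right]
    _ = Q * A * Q := by rw [Matrix.mul_assoc, left, ← Matrix.mul_assoc]
    _ = Q := q2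

theorem mul_eq_one_of_rank {k l : ℕ} {C : Matrix (Fin k) (Fin l) ℝ}
    {P : Matrix (Fin l) (Fin k) ℝ} (hP : IsMoorePenrose C P) (hC : C.rank = k) : C * P = 1 := by
  have hu : IsUnit (C * Cᵀ) := by
    apply Matrix.isUnit_of_rank_eq
    rw [Matrix.rank_self_mul_transpose, hC]
  refine hu.mul_right_cancel ?_
  rw [← Matrix.mul_assoc, hP.1, Matrix.one_mul]

theorem mul_mul_transpose {k l : ℕ} {C : Matrix (Fin k) (Fin l) ℝ}
    {P : Matrix (Fin l) (Fin k) ℝ} (hP : IsMoorePenrose C P) : P * C * Cᵀ = Cᵀ := by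
  rw [← hP.2.2.2, ← transpose_mul, ← Matrix.mul_assoc, hP.1]

/-- The pseudoinverse of a full-rank factorization `A * C`. -/
theorem mul_of_full_rank {k r l : ℕ} {A : Matrix (Fin k) (Fin r) ℝ}
    {C : Matrix (Fin r) (Fin l) ℝ} {P : Matrix (Fin l) (Fin r) ℝ} (hP : IsMoorePenrose C P)
    (hCP : C * P = 1) (hA : IsUnit (Aᵀ * A).det) :
    IsMoorePenrose (A * C) (P * (Aᵀ * A)⁻¹ * Aᵀ) := by
  have left : A * C * (P * (Aᵀ * A)⁻¹ * Aᵀ) = A * (Aᵀ * A)⁻¹ * Aᵀ := by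
    calc _ = A * (C * P) * (Aᵀ * A)⁻¹ * Aᵀ := by simp only [Matrix.mul_assoc]
      _ = _ := by rw [hCP, Matrix.mul_one]
  have right : P * (Aᵀ * A)⁻¹ * Aᵀ * (A * C) = P * C := by
    calc _ = P * ((Aᵀ * A)⁻¹ * (Aᵀ * A)) * C := by simp only [Matrix.mul_assoc]
      _ = _ := by rw [nonsing_inv_mul _ hA, Matrix.mul_one]
  refine ⟨?_, ?_, ?_, ?_⟩
  · rw [Matrix.mul_assoc, right, Matrix.mul_assoc, ← Matrix.mul_assoc C, hCP, Matrix.one_mul]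
  · rw [right]
    simp only [← Matrix.mul_assoc]
    rw [hP.2.1]
  · rw [left]
    simp [transpose_mul, transpose_nonsing_inv, Matrix.mul_assoc]
  · rw [right, hP.2.2.2]

end IsMoorePenrose

theorem sum_sq_eq_trace {k l : ℕ} (M : Matrix (Fin k) (Fin l) ℝ) :
    ∑ i, ∑ j, M i j ^ 2 = (M * Mᵀ).trace := by
  simp [Matrix.trace, Matrix.mul_apply, sq]

theorem eq_zero_of_sum_sq_eq_zero {k l : ℕ} {M : Matrix (Fin k) (Fin l) ℝ}
    (h : ∑ i, ∑ j, M i j ^ 2 = 0) : M = 0 := by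
  rw [sum_sq_eq_trace, ← conjTranspose_eq_transpose_of_trivial] at h
  exact trace_mul_conjTranspose_self_eq_zero_iff.mp h

theorem sum_sq_add_of_mul_transpose_eq_zero {k l : ℕ} {M N : Matrix (Fin k) (Fin l) ℝ}
    (h : M * Nᵀ = 0) :
    ∑ i, ∑ j, (M + N) i j ^ 2 = ∑ i, ∑ j, M i j ^ 2 + ∑ i, ∑ j, N i j ^ 2 := by
  have h' : N * Mᵀ = 0 := by
    rw [← transpose_transpose (N * Mᵀ), transpose_mul, transpose_transpose, h, transpose_zero]
  simp only [sum_sq_eq_trace]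
  rw [transpose_add, Matrix.add_mul, Matrix.mul_add, Matrix.mul_add, h, h', add_zero, zero_add,
    trace_add]

/-- Equivalence of the reduced regression problem: the minimum-norm solution
`Θ̃ = Y C⁺ G_{X̃,X̃}⁻¹` of `min_Θ ‖Y − Θ G_{X̃,X}‖_F²` satisfies `Θ̃ Ψ_X̃ᵀ = Y Ψ_X⁺`,
i.e., the reduced-kernel regression function coincides with the full regression function. -/
theorem reduced_regression_equivalence {d n m mt d' : ℕ}
    (Ψ : (Fin d → ℝ) → (Fin n → ℝ)) (X : Fin m → (Fin d → ℝ)) (xt : Fin mt → (Fin d → ℝ))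
    (hsub : ∀ j : Fin mt, ∃ j' : Fin m, xt j = X j')
    (PsiX : Matrix (Fin n) (Fin m) ℝ) (hPsiX : PsiX = Matrix.of fun i j => Ψ (X j) i)
    (PsiXt : Matrix (Fin n) (Fin mt) ℝ) (hPsiXt : PsiXt = Matrix.of fun i j => Ψ (xt j) i)
    (C : Matrix (Fin mt) (Fin m) ℝ) (hfac : PsiX = PsiXt * C)
    (hrank1 : PsiXt.rank = mt) (hrank2 : C.rank = mt)
    (Y : Matrix (Fin d') (Fin m) ℝ)
    (PC : Matrix (Fin m) (Fin mt) ℝ) (hPC : IsMoorePenrose C PC)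
    (PX : Matrix (Fin m) (Fin n) ℝ) (hPX : IsMoorePenrose PsiX PX) :
    let Θt : Matrix (Fin d') (Fin mt) ℝ := Y * PC * (PsiXtᵀ * PsiXt)⁻¹
    let R : Matrix (Fin d') (Fin mt) ℝ → ℝ :=
      fun Θ => ∑ i, ∑ j, (Y i j - (Θ * (PsiXtᵀ * PsiX)) i j) ^ 2
    IsLeast (Set.range R) (R Θt) ∧
    (∀ Θ, R Θ = R Θt → ∑ i, ∑ j, (Θt i j) ^ 2 ≤ ∑ i, ∑ j, (Θ i j) ^ 2) ∧
    Θt * PsiXtᵀ = Y * PX ∧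
    (∀ x : Fin d → ℝ, Θt *ᵥ (PsiXtᵀ *ᵥ Ψ x) = (Y * PX) *ᵥ Ψ x) := by
  intro Θt R
  have hG : IsUnit (PsiXtᵀ * PsiXt) := by
    apply Matrix.isUnit_of_rank_eq
    rw [Matrix.rank_transpose_mul_self, hrank1]
  have hGdet : IsUnit (PsiXtᵀ * PsiXt).det := (Matrix.isUnit_iff_isUnit_det _).mp hG
  have hCP : C * PC = 1 := hPC.mul_eq_one_of_rank hrank2
  have hpred : Θt * (PsiXtᵀ * PsiX) = Y * PC * C := by
    rw [hfac, ← Matrix.mul_assoc PsiXtᵀ, ← Matrix.mul_assoc,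
      nonsing_inv_mul_cancel_right _ _ hGdet]
  have horth : (Y - Θt * (PsiXtᵀ * PsiX)) * Cᵀ = 0 := by
    rw [hpred, Matrix.sub_mul, Matrix.mul_assoc, Matrix.mul_assoc, ← Matrix.mul_assoc PC,
      hPC.mul_mul_transpose, sub_self]
  have hpyth (Θ : Matrix (Fin d') (Fin mt) ℝ) :
      R Θ = R Θt + ∑ i, ∑ j, ((Θt - Θ) * (PsiXtᵀ * PsiXt) * C) i j ^ 2 := by
    have hsplit : Y - Θ * (PsiXtᵀ * PsiX) =
        (Y - Θt * (PsiXtᵀ * PsiX)) + (Θt - Θ) * (PsiXtᵀ * PsiXt) * C := by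
      rw [Matrix.mul_assoc (Θt - Θ), Matrix.mul_assoc PsiXtᵀ, ← hfac, Matrix.sub_mul]
      abel
    have h := sum_sq_add_of_mul_transpose_eq_zero
      (M := Y - Θt * (PsiXtᵀ * PsiX)) (N := (Θt - Θ) * (PsiXtᵀ * PsiXt) * C)
      (by rw [transpose_mul, ← Matrix.mul_assoc, horth, Matrix.zero_mul])
    rw [← hsplit] at h
    exact h
  have huniq (Θ : Matrix (Fin d') (Fin mt) ℝ) (h : R Θ = R Θt) : Θ = Θt := by
    have hzero : (Θt - Θ) * (PsiXtᵀ * PsiXt) * C = 0 :=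
      eq_zero_of_sum_sq_eq_zero (by linarith [hpyth Θ])
    have hzero' : (Θt - Θ) * (PsiXtᵀ * PsiXt) = 0 := by
      rw [← Matrix.mul_one ((Θt - Θ) * (PsiXtᵀ * PsiXt)), ← hCP, ← Matrix.mul_assoc, hzero,
        Matrix.zero_mul]
    have hdiff : Θt - Θ = 0 := by
      rw [← mul_nonsing_inv_cancel_right _ (Θt - Θ) hGdet, hzero', Matrix.zero_mul]
    exact (sub_eq_zero.mp hdiff).symm
  have hpinv : Θt * PsiXtᵀ = Y * PX := by
    rw [hfac] at hPX
    rw [hPX.unique (hPC.mul_of_full_rank hCP hGdet)]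
    simp only [Θt, Matrix.mul_assoc]
  refine ⟨⟨⟨Θt, rfl⟩, ?_⟩, fun Θ h => by rw [huniq Θ h], hpinv, fun x => ?_⟩
  · rintro _ ⟨Θ, rfl⟩
    rw [hpyth Θ]
    exact le_add_of_nonneg_right
      (Finset.sum_nonneg fun i _ => Finset.sum_nonneg fun j _ => sq_nonneg _)
  · rw [mulVec_mulVec, hpinv]
end
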